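/- arXiv:2101.01672 — 2 statements merged into one kernel-verified Lean document; each statement's English description precedes it below -/
import Mathlib

section
/- Let A be a real symmetric N×N Z-matrix with connectivity at most W_c ≥ 2, u a vector with all entries positive, and Ē > 0, with ρ = ρ_{A,u,Ē} and K_Ē as in the definitions, and assume the Separation Hypothesis with parameter S > 0, wells K_ℓ and neighborhoods Ω_ℓ. Fix δ > 0 and let φ be a local eigenvector of A on some Ω_ℓ with eigenvalue μ ≤ Ē − δ. Then the residual vector r := Aφ − μφ satisfies ‖r‖² ≤ (W_c²/(2δ)) · (max_{i,j∈[N]}|a_{ij}|)³ · e^{−2S/√W_c} · ‖φ‖². -/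
open scoped ENNReal BigOperators
open Matrix

/-- The effective potential `(Au)_i / u_i`. -/
noncomputable def effV {N : ℕ} (A : Matrix (Fin N) (Fin N) ℝ) (u : Fin N → ℝ) (i : Fin N) : ℝ :=
  A.mulVec u i / u i

/-- The shifted effective potential `v_i = ((Au)_i/u_i - E)_+`. -/
noncomputable def shiftedV {N : ℕ} (A : Matrix (Fin N) (Fin N) ℝ) (u : Fin N → ℝ) (E : ℝ)
    (i : Fin N) : ℝ :=
  max (effV A u i - E) 0

/-- The weight of an edge `(i,j)`: `ln(1 + √(√(v_i v_j)/|a_ij|))`. -/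
noncomputable def edgeW {N : ℕ} (A : Matrix (Fin N) (Fin N) ℝ) (u : Fin N → ℝ) (E : ℝ)
    (i j : Fin N) : ℝ≥0∞ :=
  ENNReal.ofReal
    (Real.log (1 + Real.sqrt (Real.sqrt (shiftedV A u E i * shiftedV A u E j) / |A i j|)))

/-- The Agmon-type distance `ρ_{A,u,E}(i,j)`: infimum over paths `i = i_0, …, i_L = j` with
`a_{i_ℓ i_{ℓ+1}} ≠ 0` of the total edge weight; `∞` if there is no such path. -/
noncomputable def agmonDist {N : ℕ} (A : Matrix (Fin N) (Fin N) ℝ) (u : Fin N → ℝ) (E : ℝ)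
    (i j : Fin N) : ℝ≥0∞ :=
  ⨅ (L : ℕ) (p : Fin (L + 1) → Fin N) (_ : p 0 = i) (_ : p (Fin.last L) = j)
    (_ : ∀ ℓ : Fin L, A (p ℓ.castSucc) (p ℓ.succ) ≠ 0),
    ∑ ℓ : Fin L, edgeW A u E (p ℓ.castSucc) (p ℓ.succ)

/-- `ρ(i, M) = inf_{j ∈ M} ρ(i,j)` (`∞` when `M = ∅`). -/
noncomputable def agmonDistToSet {N : ℕ} (A : Matrix (Fin N) (Fin N) ℝ) (u : Fin N → ℝ) (E : ℝ)
    (i : Fin N) (M : Finset (Fin N)) : ℝ≥0∞ :=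
  ⨅ j ∈ M, agmonDist A u E i j

/-- The well set `K_E = {i : v_i = 0} = {i : (Au)_i/u_i ≤ E}`. -/
noncomputable def wellSet {N : ℕ} (A : Matrix (Fin N) (Fin N) ℝ) (u : Fin N → ℝ) (E : ℝ) :
    Finset (Fin N) :=
  Finset.univ.filter fun i => effV A u i ≤ E

/-- A `Z`-matrix: nonpositive off-diagonal entries. -/
def IsZMatrix {N : ℕ} (A : Matrix (Fin N) (Fin N) ℝ) : Prop :=
  ∀ i j, i ≠ j → A i j ≤ 0

/-- Connectivity at most `W`: every row and column has at most `W` nonzero off-diagonal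
entries. -/
def ConnAtMost {N : ℕ} (A : Matrix (Fin N) (Fin N) ℝ) (W : ℕ) : Prop :=
  ∀ i : Fin N, (Finset.univ.filter fun j => j ≠ i ∧ A i j ≠ 0).card ≤ W ∧
    (Finset.univ.filter fun j => j ≠ i ∧ A j i ≠ 0).card ≤ W

/-- `φ` is a local eigenvector of `A` on `M` with eigenvalue `E`: `φ ≠ 0`, `I_M φ = φ`, and
`I_M A I_M φ = E φ`. -/
def IsLocalEigenvector {N : ℕ} (A : Matrix (Fin N) (Fin N) ℝ) (M : Finset (Fin N)) (E : ℝ)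
    (φ : Fin N → ℝ) : Prop :=
  φ ≠ 0 ∧ (∀ i, i ∉ M → φ i = 0) ∧ (∀ i, i ∈ M → A.mulVec φ i = E * φ i)

/-- Extended exponential `e^x` for `x ∈ [0,∞]`. -/
noncomputable def eexp (x : ℝ≥0∞) : ℝ≥0∞ :=
  if x = ⊤ then ⊤ else ENNReal.ofReal (Real.exp x.toReal)

/-- The Separation Hypothesis (Hypothesis 5.1) for `A, u, Ē` with parameter `S`: the well set
`K_Ē` is partitioned into disjoint nonempty wells `K_ℓ` with pairwise disjoint neighborhoods
`Ω_ℓ ⊇ K_ℓ` such that `ρ(Ω_ℓᶜ, K_ℓ) ≥ S` and `ρ(∂⁻Ω_ℓ, K_ℓ) ≥ S`, where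
`∂⁻Ω_ℓ = {k ∈ Ω_ℓ : a_{kj} ≠ 0 for some j ∉ Ω_ℓ}`. -/
def SeparationHypothesis {N : ℕ} (A : Matrix (Fin N) (Fin N) ℝ) (u : Fin N → ℝ)
    (Ebar S : ℝ) {m : ℕ} (Kp Ω : Fin m → Finset (Fin N)) : Prop :=
  (∀ ℓ, (Kp ℓ).Nonempty) ∧
    (∀ ℓ ℓ', ℓ ≠ ℓ' → Disjoint (Kp ℓ) (Kp ℓ')) ∧
    (Finset.univ.biUnion Kp = wellSet A u Ebar) ∧
    (∀ ℓ, Kp ℓ ⊆ Ω ℓ) ∧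
    (∀ ℓ ℓ', ℓ ≠ ℓ' → Disjoint (Ω ℓ) (Ω ℓ')) ∧
    (∀ ℓ, ∀ i ∉ Ω ℓ, ENNReal.ofReal S ≤ agmonDistToSet A u Ebar i (Kp ℓ)) ∧
    (∀ ℓ, ∀ i ∈ Ω ℓ, (∃ j, j ∉ Ω ℓ ∧ A i j ≠ 0) →
      ENNReal.ofReal S ≤ agmonDistToSet A u Ebar i (Kp ℓ))

/-- A quadratic form with nonnegative diagonal coefficients dominates its cross term. -/
lemma mul_mul_le_of_sq_le {P p q x y : ℝ} (hp : 0 ≤ p) (hq : 0 ≤ q)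
    (h : P ^ 2 ≤ 4 * (p * q)) : P * (x * y) ≤ p * x ^ 2 + q * y ^ 2 := by
  have h1 : (P * (x * y)) ^ 2 ≤ (p * x ^ 2 + q * y ^ 2) ^ 2 := by
    have h2 : P ^ 2 * (x * y) ^ 2 ≤ 4 * (p * q) * (x * y) ^ 2 :=
      mul_le_mul_of_nonneg_right h (sq_nonneg _)
    nlinarith [sq_nonneg (p * x ^ 2 - q * y ^ 2)]
  exact (le_abs_self _).trans (abs_le_of_sq_le_sq h1 (by positivity))

/-- The comparison of neighbouring Agmon weights, when both are exponential. -/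
lemma exp_weights_sq_le {r G H : ℝ} (hG : 1 ≤ G) (hH : 1 ≤ H)
    (hGH : G ≤ H * (1 + r)) (hHG : H ≤ G * (1 + r)) :
    (2 * G ^ 2 + 2 * H ^ 2) ^ 2 ≤
      4 * (1 + r ^ 2) ^ 2 * ((2 * G ^ 2 + 1) * (2 * H ^ 2 + 1)) := by
  have hd : (G - H) ^ 2 ≤ r ^ 2 * (G * H) := by
    rcases le_total G H with h | h
    · have h1 : (H - G) ^ 2 ≤ (G * r) ^ 2 :=
        pow_le_pow_left₀ (by linarith) (by linarith) 2
      have h2 : r ^ 2 * (G * G) ≤ r ^ 2 * (G * H) := by gcongr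
      nlinarith
    · have h1 : (G - H) ^ 2 ≤ (H * r) ^ 2 :=
        pow_le_pow_left₀ (by linarith) (by linarith) 2
      have h2 : r ^ 2 * (H * H) ≤ r ^ 2 * (G * H) := by gcongr
      nlinarith
  have hGH0 : 0 ≤ G * H := by positivity
  have h1 : G ^ 2 + H ^ 2 ≤ (1 + r ^ 2) * (2 * (G * H) + 1) := by
    nlinarith [mul_nonneg (sq_nonneg r) hGH0, sq_nonneg r]
  have h2 : (G ^ 2 + H ^ 2) ^ 2 ≤ ((1 + r ^ 2) * (2 * (G * H) + 1)) ^ 2 :=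
    pow_le_pow_left₀ (by positivity) h1 2
  have h3 : (2 * (G * H) + 1) ^ 2 ≤ (2 * G ^ 2 + 1) * (2 * H ^ 2 + 1) := by
    nlinarith [sq_nonneg (G - H)]
  have h4 : (1 + r ^ 2) ^ 2 * (2 * (G * H) + 1) ^ 2 ≤
      (1 + r ^ 2) ^ 2 * ((2 * G ^ 2 + 1) * (2 * H ^ 2 + 1)) := by gcongr
  nlinarith

/-- The comparison of neighbouring Agmon weights, when one of them vanishes. -/
lemma exp_weight_sq_le {r G : ℝ} (hG : 1 ≤ G) (hGr : G ≤ 1 + r) :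
    (2 * G ^ 2) ^ 2 ≤ 4 * (1 + r ^ 2) ^ 2 * (2 * G ^ 2 + 1) := by
  have h0 : (G - 1) ^ 2 ≤ r ^ 2 := pow_le_pow_left₀ (by linarith) (by linarith) 2
  rcases le_total (G ^ 2) 2 with h | h
  · have h1 : 1 ≤ (1 + r ^ 2) ^ 2 := by nlinarith [sq_nonneg r, sq_nonneg (r ^ 2)]
    have h2 : 2 * G ^ 2 + 1 ≤ (1 + r ^ 2) ^ 2 * (2 * G ^ 2 + 1) :=
      le_mul_of_one_le_left (by positivity) h1
    nlinarith [sq_nonneg G]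
  · have h1 : G ^ 2 / 2 ≤ 1 + r ^ 2 := by nlinarith [sq_nonneg (G - 2)]
    have h2 : (G ^ 2 / 2) ^ 2 ≤ (1 + r ^ 2) ^ 2 := pow_le_pow_left₀ (by positivity) h1 2
    have h3 : (G ^ 2 / 2) ^ 2 * (2 * G ^ 2 + 1) ≤ (1 + r ^ 2) ^ 2 * (2 * G ^ 2 + 1) := by gcongr
    have h4 : 0 ≤ (G ^ 2) ^ 2 * (2 * G ^ 2 + 1 - 4) :=
      mul_nonneg (by positivity) (by linarith)
    nlinarith

/-- The two ways `G` and `w` may be related: `w = 2 G²`, or `w = 0` and `G = 1`. -/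
lemma agmon_weights_sq_le {r G H w z : ℝ} (hG : 1 ≤ G) (hH : 1 ≤ H)
    (hGH : G ≤ H * (1 + r)) (hHG : H ≤ G * (1 + r))
    (hw : w = 2 * G ^ 2 ∨ (w = 0 ∧ G = 1)) (hz : z = 2 * H ^ 2 ∨ (z = 0 ∧ H = 1)) :
    (w + z) ^ 2 ≤ 4 * (1 + r ^ 2) ^ 2 * ((w + 1) * (z + 1)) := by
  rcases hw with rfl | ⟨rfl, rfl⟩ <;> rcases hz with rfl | ⟨rfl, rfl⟩
  · exact exp_weights_sq_le hG hH hGH hHG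
  · simpa using exp_weight_sq_le hG (by linarith)
  · simpa using exp_weight_sq_le hH (by linarith)
  · simpa using sq_nonneg (1 + r ^ 2)

/-- The weighted energy inequality: a positive subsolution `θ` of a symmetric nonnegative system
on `R` has weighted mass controlled by its energy on `R`. -/
lemma weighted_energy_le {ι : Type*} [Fintype ι] [DecidableEq ι] (R : Finset ι)
    (b e : ι → ι → ℝ) (d θ w : ι → ℝ) (δ : ℝ) (hb : ∀ i j, b i j = b j i)
    (hθ : ∀ i, 0 ≤ θ i) (hw : ∀ i, 0 ≤ w i) (hwR : ∀ i ∉ R, w i = 0)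
    (hsub : ∀ i ∈ R, (d i + δ) * θ i ≤ ∑ j, b i j * θ j)
    (he : ∀ i ∈ R, ∑ j, e i j ≤ d i)
    (hedge : ∀ i j, b i j * (w i + w j) * (θ i * θ j) ≤
      (w i + if i ∈ R then 1 else 0) * e i j * θ i ^ 2 +
      (w j + if j ∈ R then 1 else 0) * e j i * θ j ^ 2) :
    δ * ∑ i, w i * θ i ^ 2 ≤ ∑ i ∈ R, d i * θ i ^ 2 := by
  set l : ι → ℝ := fun i => if i ∈ R then 1 else 0 with hl
  have h1 : ∑ i, w i * (d i + δ) * θ i ^ 2 ≤ ∑ i, ∑ j, b i j * w i * (θ i * θ j) := by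
    refine Finset.sum_le_sum fun i _ => ?_
    by_cases hi : i ∈ R
    · have := mul_le_mul_of_nonneg_left (hsub i hi) (mul_nonneg (hw i) (hθ i))
      calc w i * (d i + δ) * θ i ^ 2 = w i * θ i * ((d i + δ) * θ i) := by ring
        _ ≤ w i * θ i * ∑ j, b i j * θ j := this
        _ = _ := by
          rw [Finset.mul_sum]
          exact Finset.sum_congr rfl fun j _ => by ring
    · simp [hwR i hi]
  have h2 : ∑ i, ∑ j, b i j * w j * (θ i * θ j) = ∑ i, ∑ j, b i j * w i * (θ i * θ j) := by
    rw [Finset.sum_comm]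
    refine Finset.sum_congr rfl fun i _ => Finset.sum_congr rfl fun j _ => ?_
    rw [hb j i]; ring
  have h3 : ∑ i, ∑ j, b i j * (w i + w j) * (θ i * θ j) =
      2 * ∑ i, ∑ j, b i j * w i * (θ i * θ j) := by
    rw [two_mul]
    nth_rewrite 2 [← h2]
    simp only [← Finset.sum_add_distrib]
    exact Finset.sum_congr rfl fun i _ => Finset.sum_congr rfl fun j _ => by ring
  have h4 : ∑ i, ∑ j, b i j * (w i + w j) * (θ i * θ j) ≤
      2 * ∑ i, ∑ j, (w i + l i) * e i j * θ i ^ 2 := by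
    calc _ ≤ ∑ i, ∑ j, ((w i + l i) * e i j * θ i ^ 2 + (w j + l j) * e j i * θ j ^ 2) :=
          Finset.sum_le_sum fun i _ => Finset.sum_le_sum fun j _ => hedge i j
      _ = _ := by
        simp only [Finset.sum_add_distrib]
        rw [two_mul]
        congr 1
        exact Finset.sum_comm
  have h5 : ∑ i, ∑ j, (w i + l i) * e i j * θ i ^ 2 ≤ ∑ i, (w i + l i) * d i * θ i ^ 2 := by
    refine Finset.sum_le_sum fun i _ => ?_
    rw [← Finset.sum_mul, ← Finset.mul_sum]
    by_cases hi : i ∈ R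
    · have : 0 ≤ w i + l i := by simp only [hl, if_pos hi]; linarith [hw i]
      gcongr
      exact he i hi
    · simp [hl, hi, hwR i hi]
  have h6 : ∑ i, (w i + l i) * d i * θ i ^ 2 =
      ∑ i, w i * d i * θ i ^ 2 + ∑ i ∈ R, d i * θ i ^ 2 := by
    simp only [add_mul, Finset.sum_add_distrib, hl, ite_mul, one_mul, zero_mul]
    simp
  have h7 : ∑ i, w i * (d i + δ) * θ i ^ 2 =
      ∑ i, w i * d i * θ i ^ 2 + δ * ∑ i, w i * θ i ^ 2 := by
    rw [Finset.mul_sum, ← Finset.sum_add_distrib]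
    exact Finset.sum_congr rfl fun i _ => by ring
  linarith

section AgmonDistance

variable {N : ℕ} {A : Matrix (Fin N) (Fin N) ℝ} {u : Fin N → ℝ} {E : ℝ}

lemma agmonDist_le_edgeW_add {i j k : Fin N} (h : A i j ≠ 0) :
    agmonDist A u E i k ≤ edgeW A u E i j + agmonDist A u E j k := by
  unfold agmonDist
  simp only [ENNReal.add_iInf]
  refine le_iInf fun L => le_iInf fun p => le_iInf fun h0 => le_iInf fun hL => le_iInf fun hp => ?_
  refine iInf_le_of_le (L + 1) <| iInf_le_of_le (Fin.cons i p) <| iInf_le_of_le rfl <|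
    iInf_le_of_le ?_ <| iInf_le_of_le ?_ ?_
  · simpa [← Fin.succ_last] using hL
  · intro ℓ
    refine Fin.cases ?_ (fun ℓ => ?_) ℓ
    · simpa [h0] using h
    · simpa [← Fin.succ_castSucc] using hp ℓ
  · rw [Fin.sum_univ_succ]
    simp [h0]

lemma agmonDist_self (i : Fin N) : agmonDist A u E i i = 0 := by
  refine le_antisymm ?_ bot_le
  exact iInf_le_of_le 0 <| iInf_le_of_le (fun _ => i) <| iInf_le_of_le rfl <|
    iInf_le_of_le rfl <| iInf_le_of_le (fun ℓ => ℓ.elim0) (by simp)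

lemma agmonDistToSet_of_mem {i : Fin N} {M : Finset (Fin N)} (hi : i ∈ M) :
    agmonDistToSet A u E i M = 0 :=
  le_antisymm ((iInf₂_le i hi).trans (agmonDist_self i).le) bot_le

lemma agmonDistToSet_le_edgeW_add {i j : Fin N} {M : Finset (Fin N)} (h : A i j ≠ 0) :
    agmonDistToSet A u E i M ≤ edgeW A u E i j + agmonDistToSet A u E j M := by
  unfold agmonDistToSet
  simp only [ENNReal.add_iInf]
  exact le_iInf₂ fun k hk => (iInf₂_le k hk).trans (agmonDist_le_edgeW_add h)

/-- The Agmon distance to `M`, truncated at `S`, as a real number. -/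
noncomputable def truncDist (A : Matrix (Fin N) (Fin N) ℝ) (u : Fin N → ℝ) (E S : ℝ)
    (M : Finset (Fin N)) (i : Fin N) : ℝ :=
  (min (agmonDistToSet A u E i M) (ENNReal.ofReal S)).toReal

lemma truncDist_nonneg (S : ℝ) (M : Finset (Fin N)) (i : Fin N) :
    0 ≤ truncDist A u E S M i := ENNReal.toReal_nonneg

lemma truncDist_of_mem {S : ℝ} {M : Finset (Fin N)} {i : Fin N} (hi : i ∈ M) :
    truncDist A u E S M i = 0 := by
  simp [truncDist, agmonDistToSet_of_mem hi]

lemma truncDist_of_le {S : ℝ} (hS : 0 ≤ S) {M : Finset (Fin N)} {i : Fin N}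
    (hi : ENNReal.ofReal S ≤ agmonDistToSet A u E i M) : truncDist A u E S M i = S := by
  rw [truncDist, min_eq_right hi, ENNReal.toReal_ofReal hS]

lemma truncDist_le_add {S : ℝ} {M : Finset (Fin N)} {i j : Fin N} (h : A i j ≠ 0) :
    truncDist A u E S M i ≤ truncDist A u E S M j + Real.log (1 + Real.sqrt
      (Real.sqrt (shiftedV A u E i * shiftedV A u E j) / |A i j|)) := by
  have hlog : 0 ≤ Real.log (1 + Real.sqrt
      (Real.sqrt (shiftedV A u E i * shiftedV A u E j) / |A i j|)) :=
    Real.log_nonneg (le_add_of_nonneg_right (Real.sqrt_nonneg _))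
  have hj : min (agmonDistToSet A u E j M) (ENNReal.ofReal S) ≠ ⊤ :=
    (min_le_right _ _).trans_lt ENNReal.ofReal_lt_top |>.ne
  have hW : edgeW A u E i j ≠ ⊤ := ENNReal.ofReal_ne_top
  have key : min (agmonDistToSet A u E i M) (ENNReal.ofReal S) ≤
      min (agmonDistToSet A u E j M) (ENNReal.ofReal S) + edgeW A u E i j := by
    rw [min_add]
    refine le_min ((min_le_left _ _).trans ?_) ((min_le_right _ _).trans le_self_add)
    rw [add_comm]
    exact agmonDistToSet_le_edgeW_add h
  have := ENNReal.toReal_mono (ENNReal.add_ne_top.2 ⟨hj, hW⟩) key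
  rw [ENNReal.toReal_add hj hW, edgeW, ENNReal.toReal_ofReal hlog] at this
  exact this

lemma truncDist_of_adj {S : ℝ} {M : Finset (Fin N)} {i j : Fin N} (h : A i j ≠ 0) (hj : j ∈ M)
    (hv : shiftedV A u E j = 0) : truncDist A u E S M i = 0 := by
  refine le_antisymm ?_ (truncDist_nonneg S M i)
  simpa [hv, truncDist_of_mem hj] using truncDist_le_add (u := u) (E := E) (S := S) (M := M) h

/-- The rescaled exponential of the truncated distance varies by a controlled factor along an
edge. -/
lemma exp_truncDist_le {S W : ℝ} (hW : 1 ≤ W) {M : Finset (Fin N)} {i j : Fin N} (h : A i j ≠ 0) :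
    Real.exp (truncDist A u E S M i / Real.sqrt W) ≤
      Real.exp (truncDist A u E S M j / Real.sqrt W) * (1 + Real.sqrt
        (Real.sqrt (shiftedV A u E i * shiftedV A u E j) / |A i j|) / Real.sqrt W) := by
  set s := Real.sqrt (Real.sqrt (shiftedV A u E i * shiftedV A u E j) / |A i j|) with hs
  have hs0 : 0 ≤ s := Real.sqrt_nonneg _
  have hq : 1 ≤ Real.sqrt W := Real.one_le_sqrt.2 hW
  have hq0 : 0 < Real.sqrt W := by linarith
  have h1 := div_le_div_of_nonneg_right (truncDist_le_add (u := u) (E := E) (S := S) (M := M) h)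
    hq0.le
  rw [← hs, add_div] at h1
  refine (Real.exp_le_exp.2 h1).trans ?_
  rw [Real.exp_add]
  gcongr
  have h2 : Real.exp (Real.log (1 + s) / Real.sqrt W) = (1 + s) ^ (1 / Real.sqrt W) := by
    rw [Real.rpow_def_of_pos (by linarith), mul_one_div]
  rw [h2]
  have := rpow_one_add_le_one_add_mul_self (s := s) (by linarith) (p := 1 / Real.sqrt W)
    (by positivity) (by rw [div_le_one hq0]; exact hq)
  rwa [one_div_mul_eq_div] at this

end AgmonDistance

/-- The absolute value of the off-diagonal part of a matrix. -/
def offDiagAbs {N : ℕ} (A : Matrix (Fin N) (Fin N) ℝ) (i j : Fin N) : ℝ :=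
  if j = i then 0 else |A i j|

section OffDiagonal

variable {N : ℕ} {A : Matrix (Fin N) (Fin N) ℝ}

lemma offDiagAbs_nonneg (i j : Fin N) : 0 ≤ offDiagAbs A i j := by
  unfold offDiagAbs; split_ifs <;> positivity

lemma offDiagAbs_ne_zero {i j : Fin N} : offDiagAbs A i j ≠ 0 ↔ j ≠ i ∧ A i j ≠ 0 := by
  simp [offDiagAbs]

lemma offDiagAbs_symm (hA : A.IsSymm) (i j : Fin N) : offDiagAbs A i j = offDiagAbs A j i := by
  simp [offDiagAbs, eq_comm, hA.apply]

lemma mulVec_eq_diag_sub (hZ : IsZMatrix A) (x : Fin N → ℝ) (i : Fin N) :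
    A.mulVec x i = A i i * x i - ∑ j, offDiagAbs A i j * x j := by
  rw [eq_sub_iff_add_eq, Matrix.mulVec, dotProduct, ← Finset.sum_add_distrib,
    Finset.sum_eq_single i]
  · simp [offDiagAbs]
  · intro j _ hj
    rw [offDiagAbs, if_neg hj, abs_of_nonpos (hZ i j hj.symm)]
    ring
  · simp

/-- Kato's inequality: `|φ|` is a subsolution wherever `φ` solves the eigenvalue equation. -/
lemma diag_sub_mul_abs_le (hZ : IsZMatrix A) {φ : Fin N → ℝ} {μ : ℝ} {i : Fin N}
    (h : A.mulVec φ i = μ * φ i) :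
    (A i i - μ) * |φ i| ≤ ∑ j, offDiagAbs A i j * |φ j| := by
  rw [mulVec_eq_diag_sub hZ] at h
  calc (A i i - μ) * |φ i| ≤ |A i i - μ| * |φ i| :=
        mul_le_mul_of_nonneg_right (le_abs_self _) (abs_nonneg _)
    _ = |∑ j, offDiagAbs A i j * φ j| := by rw [← abs_mul]; congr 1; linarith
    _ ≤ ∑ j, |offDiagAbs A i j * φ j| := Finset.abs_sum_le_sum_abs _ _
    _ = _ := Finset.sum_congr rfl fun j _ => by
      rw [abs_mul, abs_of_nonneg (offDiagAbs_nonneg i j)]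

lemma diag_eq_effV_add (hZ : IsZMatrix A) {u : Fin N → ℝ} (hu : ∀ i, 0 < u i) (i : Fin N) :
    A i i = effV A u i + ∑ j, offDiagAbs A i j * (u j / u i) := by
  have := (hu i).ne'
  simp only [effV, mulVec_eq_diag_sub hZ, sub_div, Finset.sum_div, mul_div_assoc]
  rw [div_self this]
  ring

/-- The share of the diagonal entry `A i i - E` that is attributed to the edge `(i, j)`. -/
noncomputable def edgeShare (A : Matrix (Fin N) (Fin N) ℝ) (u : Fin N → ℝ) (E W : ℝ)
    (i j : Fin N) : ℝ :=
  offDiagAbs A i j * (u j / u i) + if offDiagAbs A i j ≠ 0 then shiftedV A u E i / W else 0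

lemma shiftedV_nonneg (u : Fin N → ℝ) (E : ℝ) (i : Fin N) : 0 ≤ shiftedV A u E i :=
  le_max_right _ _

lemma edgeShare_nonneg {u : Fin N → ℝ} (hu : ∀ i, 0 < u i) {E W : ℝ} (hW : 0 ≤ W)
    (i j : Fin N) : 0 ≤ edgeShare A u E W i j := by
  have h1 := offDiagAbs_nonneg (A := A) i j
  have h2 := shiftedV_nonneg (A := A) u E i
  have := hu i
  have := hu j
  unfold edgeShare
  split_ifs <;> positivity

lemma sum_edgeShare_le (hZ : IsZMatrix A) {W : ℕ} (hW : 0 < W) (hconn : ConnAtMost A W)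
    {u : Fin N → ℝ} (hu : ∀ i, 0 < u i) {E : ℝ} {i : Fin N} (hi : E ≤ effV A u i) :
    ∑ j, edgeShare A u E W i j ≤ A i i - E := by
  simp only [edgeShare, Finset.sum_add_distrib]
  rw [diag_eq_effV_add hZ hu i, ← Finset.sum_filter, Finset.sum_const, nsmul_eq_mul]
  have hv : shiftedV A u E i = effV A u i - E := max_eq_left (by linarith)
  have hcard : ((Finset.univ.filter fun j => offDiagAbs A i j ≠ 0).card : ℝ) ≤ W := by
    simp only [offDiagAbs_ne_zero]
    exact_mod_cast (hconn i).1
  have hW' : (0 : ℝ) < W := by exact_mod_cast hW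
  have : ((Finset.univ.filter fun j => offDiagAbs A i j ≠ 0).card : ℝ) * (shiftedV A u E i / W) ≤
      W * (shiftedV A u E i / W) :=
    mul_le_mul_of_nonneg_right hcard (div_nonneg (shiftedV_nonneg u E i) hW'.le)
  rw [mul_div_cancel₀ _ hW'.ne', hv] at this
  rw [hv]
  linarith

/-- The product of the two shares of an edge bounds the squared matrix entry from above with an
Agmon gain. -/
lemma sq_le_edgeShare_mul (hA : A.IsSymm) {u : Fin N → ℝ} (hu : ∀ i, 0 < u i) {E W : ℝ}
    (hW : 0 < W) {i j : Fin N} (hij : offDiagAbs A i j ≠ 0) :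
    (|A i j| * (1 + (Real.sqrt (Real.sqrt (shiftedV A u E i * shiftedV A u E j) / |A i j|) /
      Real.sqrt W) ^ 2)) ^ 2 ≤ edgeShare A u E W i j * edgeShare A u E W j i := by
  have hji : offDiagAbs A j i ≠ 0 := by rwa [offDiagAbs_symm hA]
  obtain ⟨hne, h0⟩ := offDiagAbs_ne_zero.1 hij
  have hb : offDiagAbs A i j = |A i j| := if_neg hne
  have ha : 0 < |A i j| := abs_pos.2 h0
  rw [edgeShare, edgeShare, if_pos hij, if_pos hji, offDiagAbs_symm hA j i, hb]
  have hvi := shiftedV_nonneg (A := A) u E i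
  have hvj := shiftedV_nonneg (A := A) u E j
  have hui := hu i
  have huj := hu j
  set a := |A i j|
  set p := shiftedV A u E i
  set q := shiftedV A u E j
  have h1 : a * (1 + (Real.sqrt (Real.sqrt (p * q) / a) / Real.sqrt W) ^ 2) =
      a + Real.sqrt p * Real.sqrt q / W := by
    rw [div_pow, Real.sq_sqrt (by positivity), Real.sq_sqrt hW.le, Real.sqrt_mul hvi]
    field_simp
  rw [h1]
  obtain ⟨x, hx, hx'⟩ : ∃ x, 0 ≤ x ∧ x ^ 2 = p := ⟨_, Real.sqrt_nonneg _, Real.sq_sqrt hvi⟩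
  obtain ⟨y, hy, hy'⟩ : ∃ y, 0 ≤ y ∧ y ^ 2 = q := ⟨_, Real.sqrt_nonneg _, Real.sq_sqrt hvj⟩
  rw [← hx', ← hy', Real.sqrt_sq hx, Real.sqrt_sq hy]
  have h2 : (a * (u j / u i) + x ^ 2 / W) * (a * (u i / u j) + y ^ 2 / W) -
      (a + x * y / W) ^ 2 = a * (u j * y - u i * x) ^ 2 / (W * (u i * u j)) := by
    field_simp
    ring
  have h3 : 0 ≤ a * (u j * y - u i * x) ^ 2 / (W * (u i * u j)) := by positivity
  linarith

end OffDiagonal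

/-- Weighted mass bound for a local eigenvector: the points of `Ω` at truncated Agmon distance
`S` from the well carry exponentially small mass. -/
lemma mass_far_from_well_le {N : ℕ} {A : Matrix (Fin N) (Fin N) ℝ}
    (hA : A.IsSymm) (hZ : IsZMatrix A) {W : ℕ} (hW : 0 < W) (hconn : ConnAtMost A W)
    {u : Fin N → ℝ} (hu : ∀ i, 0 < u i) {E : ℝ} (hE : 0 < E) {S : ℝ} (hS : 0 < S)
    {K Ω F : Finset (Fin N)} (hK : K = Ω.filter fun i => effV A u i ≤ E)
    (hF : F ⊆ Ω) (hFS : ∀ i ∈ F, ENNReal.ofReal S ≤ agmonDistToSet A u E i K)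
    {δ : ℝ} (hδ : 0 < δ) {φ : Fin N → ℝ} {μ : ℝ} (hμ : μ ≤ E - δ)
    (hφ : IsLocalEigenvector A Ω μ φ) {m : ℝ} (hm : ∀ i j, |A i j| ≤ m) :
    2 * δ * Real.exp (2 * S / Real.sqrt W) * ∑ i ∈ F, φ i ^ 2 ≤ m * ∑ i, φ i ^ 2 := by
  obtain ⟨-, hφΩ, hφe⟩ := hφ
  set D := truncDist A u E S K with hD
  set G : Fin N → ℝ := fun i => Real.exp (D i / Real.sqrt W) with hGdef
  set w : Fin N → ℝ := fun i => if i ∈ Ω ∧ D i ≠ 0 then 2 * G i ^ 2 else 0 with hwdef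
  have hW1 : (1 : ℝ) ≤ W := by exact_mod_cast hW
  have hW0 : (0 : ℝ) < W := by linarith
  have hvK : ∀ i ∈ K, shiftedV A u E i = 0 := fun i hi => by
    rw [hK, Finset.mem_filter] at hi
    exact max_eq_right (by linarith [hi.2])
  have hDK : ∀ i ∈ K, D i = 0 := fun i hi => truncDist_of_mem hi
  have hw0 : ∀ i, 0 ≤ w i := fun i => by simp only [hwdef]; split_ifs <;> positivity
  have hmemR : ∀ i ∈ Ω \ K, i ∈ Ω ∧ E < effV A u i := fun i hi => by
    rw [Finset.mem_sdiff, hK, Finset.mem_filter] at hi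
    exact ⟨hi.1, not_le.1 fun h => hi.2 ⟨hi.1, h⟩⟩
  have hG1 : ∀ i, 1 ≤ G i := fun i =>
    Real.one_le_exp (div_nonneg (truncDist_nonneg S K i) (Real.sqrt_nonneg _))
  have hwG : ∀ i ∈ Ω, w i = 2 * G i ^ 2 ∨ (w i = 0 ∧ G i = 1) := fun i hi => by
    by_cases h : D i = 0
    · right; simp [hwdef, hGdef, h]
    · left; simp [hwdef, hi, h]
  have hmain : δ * ∑ i, w i * |φ i| ^ 2 ≤ ∑ i ∈ Ω \ K, (A i i - E) * |φ i| ^ 2 := by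
    refine weighted_energy_le (Ω \ K) (offDiagAbs A) (edgeShare A u E W) (fun i => A i i - E)
      (fun i => |φ i|) w δ (offDiagAbs_symm hA) (fun i => abs_nonneg _) hw0 ?_ ?_ ?_ ?_
    · intro i hi
      refine if_neg fun h => hi (Finset.mem_sdiff.2 ⟨h.1, fun hiK => h.2 (hDK i hiK)⟩)
    · intro i hi
      refine le_trans ?_ (diag_sub_mul_abs_le hZ (hφe i (hmemR i hi).1))
      exact mul_le_mul_of_nonneg_right (by linarith) (abs_nonneg _)
    · exact fun i hi => sum_edgeShare_le hZ hW hconn hu (hmemR i hi).2.le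
    · intro i j
      have hpos : ∀ i j, 0 ≤ (w i + if i ∈ Ω \ K then 1 else 0) * edgeShare A u E W i j :=
        fun i j => mul_nonneg (add_nonneg (hw0 i) (by split_ifs <;> norm_num))
          (edgeShare_nonneg hu hW0.le i j)
      have hrhs := add_nonneg (mul_nonneg (hpos i j) (sq_nonneg |φ i|))
        (mul_nonneg (hpos j i) (sq_nonneg |φ j|))
      by_cases hb : offDiagAbs A i j = 0
      · simpa [hb] using hrhs
      by_cases hww : w i + w j = 0
      · simpa [hww] using hrhs
      by_cases hi : i ∈ Ω
      swap
      · simpa [hφΩ i hi] using hrhs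
      by_cases hj : j ∈ Ω
      swap
      · simpa [hφΩ j hj] using hrhs
      have haij : A i j ≠ 0 := (offDiagAbs_ne_zero.1 hb).2
      have haji : A j i ≠ 0 := by rwa [hA.apply]
      have hiK : i ∉ K := fun h => hww (by
        have hadj : D j = 0 := truncDist_of_adj haji h (hvK i h)
        simp [hwdef, hDK i h, hadj])
      have hjK : j ∉ K := fun h => hww (by
        have hadj : D i = 0 := truncDist_of_adj haij h (hvK j h)
        simp [hwdef, hDK j h, hadj])
      rw [if_pos (Finset.mem_sdiff.2 ⟨hi, hiK⟩), if_pos (Finset.mem_sdiff.2 ⟨hj, hjK⟩)]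
      refine mul_mul_le_of_sq_le (mul_nonneg (by linarith [hw0 i]) (edgeShare_nonneg hu hW0.le i j))
        (mul_nonneg (by linarith [hw0 j]) (edgeShare_nonneg hu hW0.le j i)) ?_
      set r := Real.sqrt (Real.sqrt (shiftedV A u E i * shiftedV A u E j) / |A i j|) /
        Real.sqrt W with hr
      have hGH : G i ≤ G j * (1 + r) := exp_truncDist_le hW1 haij
      have hHG : G j ≤ G i * (1 + r) := by
        have := exp_truncDist_le (u := u) (E := E) (S := S) (M := K) hW1 haji
        rwa [mul_comm (shiftedV A u E j), hA.apply] at this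
      have hweights := agmon_weights_sq_le (hG1 i) (hG1 j) hGH hHG (hwG i hi) (hwG j hj)
      have hshare := sq_le_edgeShare_mul (E := E) hA hu hW0 hb
      rw [← hr] at hshare
      have hbe : offDiagAbs A i j = |A i j| := if_neg (offDiagAbs_ne_zero.1 hb).1
      have hprod : 0 ≤ (w i + 1) * (w j + 1) :=
        mul_nonneg (by linarith [hw0 i]) (by linarith [hw0 j])
      calc (offDiagAbs A i j * (w i + w j)) ^ 2 = |A i j| ^ 2 * (w i + w j) ^ 2 := by
            rw [hbe, mul_pow]
        _ ≤ |A i j| ^ 2 * (4 * (1 + r ^ 2) ^ 2 * ((w i + 1) * (w j + 1))) := by gcongr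
        _ = 4 * ((w i + 1) * (w j + 1)) * (|A i j| * (1 + r ^ 2)) ^ 2 := by ring
        _ ≤ 4 * ((w i + 1) * (w j + 1)) * (edgeShare A u E W i j * edgeShare A u E W j i) := by
            gcongr
        _ = _ := by ring
  simp only [sq_abs] at hmain
  have hleft : 2 * Real.exp (2 * S / Real.sqrt W) * ∑ i ∈ F, φ i ^ 2 ≤ ∑ i, w i * φ i ^ 2 := by
    rw [Finset.mul_sum]
    refine le_trans (Finset.sum_le_sum fun i hi => ?_) (Finset.sum_le_sum_of_subset_of_nonneg
      (Finset.subset_univ F) fun i _ _ => mul_nonneg (hw0 i) (sq_nonneg _))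
    have hDi : D i = S := truncDist_of_le hS.le (hFS i hi)
    have : w i = 2 * Real.exp (2 * S / Real.sqrt W) := by
      simp only [hwdef, hGdef, hDi]
      rw [if_pos ⟨hF hi, hS.ne'⟩, ← Real.exp_nat_mul]
      congr 2
      push_cast
      ring
    rw [this]
  have hm0 : ∀ i : Fin N, 0 ≤ m := fun i => (abs_nonneg _).trans (hm i i)
  have hright : ∑ i ∈ Ω \ K, (A i i - E) * φ i ^ 2 ≤ m * ∑ i, φ i ^ 2 := by
    rw [Finset.mul_sum]
    refine le_trans (Finset.sum_le_sum fun i _ => ?_) (Finset.sum_le_sum_of_subset_of_nonneg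
      (Finset.subset_univ (Ω \ K)) fun i _ _ => mul_nonneg (hm0 i) (sq_nonneg _))
    have := (le_abs_self _).trans (hm i i)
    gcongr
    linarith
  calc _ = δ * (2 * Real.exp (2 * S / Real.sqrt W) * ∑ i ∈ F, φ i ^ 2) := by ring
    _ ≤ δ * ∑ i, w i * φ i ^ 2 := by gcongr
    _ ≤ _ := hmain.trans hright

/-- The residual of a local eigenvector is controlled by its mass on any set `F` containing the
inner boundary of `Ω`. -/
lemma residual_sq_le_boundary_mass {N : ℕ} {A : Matrix (Fin N) (Fin N) ℝ} (hA : A.IsSymm)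
    {W : ℕ} (hconn : ConnAtMost A W) {Ω F : Finset (Fin N)}
    (hF : ∀ i ∈ Ω, (∃ j, j ∉ Ω ∧ A i j ≠ 0) → i ∈ F) {φ : Fin N → ℝ} {μ : ℝ}
    (hφ : IsLocalEigenvector A Ω μ φ) {m : ℝ} (hm : ∀ i j, |A i j| ≤ m) :
    ∑ k, (A.mulVec φ k - μ * φ k) ^ 2 ≤ (W : ℝ) ^ 2 * m ^ 2 * ∑ i ∈ F, φ i ^ 2 := by
  obtain ⟨-, hφΩ, hφe⟩ := hφ
  have hrow : ∀ k, (A.mulVec φ k - μ * φ k) ^ 2 ≤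
      W * m ^ 2 * ∑ j ∈ F, if j ≠ k ∧ A k j ≠ 0 then φ j ^ 2 else 0 := by
    intro k
    have hnn : 0 ≤ (W : ℝ) * m ^ 2 * ∑ j ∈ F, if j ≠ k ∧ A k j ≠ 0 then φ j ^ 2 else 0 :=
      mul_nonneg (by positivity) (Finset.sum_nonneg fun j _ => by split_ifs <;> positivity)
    by_cases hk : k ∈ Ω
    · simpa [hφe k hk] using hnn
    set T := F.filter fun j => j ≠ k ∧ A k j ≠ 0 with hT
    have hsum : A.mulVec φ k - μ * φ k = ∑ j ∈ T, A k j * φ j := by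
      rw [hφΩ k hk, mul_zero, sub_zero, Matrix.mulVec, dotProduct]
      refine (Finset.sum_subset (Finset.subset_univ T) fun j _ hj => ?_).symm
      by_contra hne
      obtain ⟨h1, h2⟩ := mul_ne_zero_iff.1 hne
      have hjΩ : j ∈ Ω := by_contra fun h => h2 (hφΩ j h)
      refine hj (Finset.mem_filter.2 ⟨hF j hjΩ ⟨k, hk, by rwa [hA.apply]⟩, ?_, h1⟩)
      rintro rfl
      exact hk hjΩ
    have hcard : (T.card : ℝ) ≤ W := by
      have : T.card ≤ W := (Finset.card_le_card
        (Finset.filter_subset_filter _ (Finset.subset_univ F))).trans (hconn k).1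
      exact_mod_cast this
    rw [hsum, ← Finset.sum_filter, ← hT]
    calc (∑ j ∈ T, A k j * φ j) ^ 2 ≤ T.card * ∑ j ∈ T, (A k j * φ j) ^ 2 :=
          sq_sum_le_card_mul_sum_sq
      _ ≤ W * ∑ j ∈ T, m ^ 2 * φ j ^ 2 := by
          refine mul_le_mul hcard (Finset.sum_le_sum fun j _ => ?_)
            (Finset.sum_nonneg fun j _ => sq_nonneg _) (Nat.cast_nonneg W)
          rw [mul_pow, ← sq_abs (A k j)]
          have := hm k j
          gcongr
      _ = _ := by rw [← Finset.mul_sum, mul_assoc]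
  calc _ ≤ ∑ k, W * m ^ 2 * ∑ j ∈ F, (if j ≠ k ∧ A k j ≠ 0 then φ j ^ 2 else 0) :=
        Finset.sum_le_sum fun k _ => hrow k
    _ = W * m ^ 2 * ∑ j ∈ F, ∑ k, (if j ≠ k ∧ A k j ≠ 0 then φ j ^ 2 else 0) := by
        rw [← Finset.mul_sum, Finset.sum_comm]
    _ ≤ W * m ^ 2 * ∑ j ∈ F, W * φ j ^ 2 := by
        refine mul_le_mul_of_nonneg_left (Finset.sum_le_sum fun j _ => ?_) (by positivity)
        rw [← Finset.sum_filter, Finset.sum_const, nsmul_eq_mul]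
        refine mul_le_mul_of_nonneg_right ?_ (sq_nonneg _)
        have := (hconn j).2
        simp only [ne_comm (b := j)] at this
        exact_mod_cast this
    _ = _ := by rw [← Finset.mul_sum]; ring

lemma SeparationHypothesis.well_eq {N : ℕ} {A : Matrix (Fin N) (Fin N) ℝ} {u : Fin N → ℝ}
    {E S : ℝ} {m : ℕ} {Kp Ω : Fin m → Finset (Fin N)} (h : SeparationHypothesis A u E S Kp Ω)
    (ℓ : Fin m) : Kp ℓ = (Ω ℓ).filter fun i => effV A u i ≤ E := by
  obtain ⟨-, -, hun, hsub, hdisj, -, -⟩ := h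
  have hmem : ∀ i, (∃ ℓ', i ∈ Kp ℓ') ↔ effV A u i ≤ E := fun i => by
    simpa [wellSet] using Finset.ext_iff.1 hun i
  ext i
  rw [Finset.mem_filter]
  refine ⟨fun hi => ⟨hsub ℓ hi, (hmem i).1 ⟨ℓ, hi⟩⟩, fun ⟨hi, hv⟩ => ?_⟩
  obtain ⟨ℓ', hi'⟩ := (hmem i).2 hv
  by_cases hℓ : ℓ = ℓ'
  · rwa [hℓ]
  · exact absurd (hsub ℓ' hi') (Finset.disjoint_left.1 (hdisj ℓ ℓ' hℓ) hi)

/-- Residual bound: under the Separation Hypothesis, if `φ` is a local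
eigenvector of `A` on `Ω_ℓ` with eigenvalue `μ ≤ Ē − δ`, the residual `r := Aφ − μφ` satisfies
`‖r‖² ≤ (W_c²/(2δ))(max_{i,j}|a_{ij}|)³ e^{−2S/√W_c} ‖φ‖²`. -/
theorem residual_bound {N : ℕ} (A : Matrix (Fin N) (Fin N) ℝ)
    (hA : A.IsSymm) (hZ : IsZMatrix A) (Wc : ℕ) (hWc : 2 ≤ Wc) (hconn : ConnAtMost A Wc)
    (u : Fin N → ℝ) (hu : ∀ i, 0 < u i) (Ebar : ℝ) (hEbar : 0 < Ebar)
    (S : ℝ) (hS : 0 < S) {m : ℕ} (Kp Ω : Fin m → Finset (Fin N))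
    (hsep : SeparationHypothesis A u Ebar S Kp Ω)
    (δ : ℝ) (hδ : 0 < δ) (ℓ : Fin m) (φ : Fin N → ℝ) (μ : ℝ) (hμ : μ ≤ Ebar - δ)
    (hφ : IsLocalEigenvector A (Ω ℓ) μ φ) :
    ∑ k : Fin N, (A.mulVec φ k - μ * φ k) ^ 2
      ≤ (Wc : ℝ) ^ 2 / (2 * δ) * (⨆ i : Fin N, ⨆ j : Fin N, |A i j|) ^ 3 *
          Real.exp (-(2 * S) / Real.sqrt Wc) * ∑ k : Fin N, φ k ^ 2 := by
  set M := ⨆ i : Fin N, ⨆ j : Fin N, |A i j| with hMdef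
  have hm : ∀ i j, |A i j| ≤ M := fun i j =>
    (le_ciSup (f := fun j => |A i j|) (Set.finite_range _).bddAbove j).trans
      (le_ciSup (f := fun i => ⨆ j : Fin N, |A i j|) (Set.finite_range _).bddAbove i)
  classical
  set F := (Ω ℓ).filter fun i => ∃ j, j ∉ Ω ℓ ∧ A i j ≠ 0 with hF
  have hbdry := hsep.2.2.2.2.2.2 ℓ
  have hmass := mass_far_from_well_le hA hZ (by omega) hconn hu hEbar hS (hsep.well_eq ℓ)
    (Finset.filter_subset _ _) (fun i hi => hbdry i (Finset.mem_filter.1 hi).1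
      (Finset.mem_filter.1 hi).2) hδ hμ hφ hm
  have hres := residual_sq_le_boundary_mass (F := F) hA hconn
    (fun i hi h => Finset.mem_filter.2 ⟨hi, h⟩) hφ hm
  refine hres.trans ?_
  have hexp : Real.exp (-(2 * S) / Real.sqrt Wc) * Real.exp (2 * S / Real.sqrt Wc) = 1 := by
    rw [← Real.exp_add, neg_div, neg_add_cancel, Real.exp_zero]
  calc (Wc : ℝ) ^ 2 * M ^ 2 * ∑ i ∈ F, φ i ^ 2
      = (Wc : ℝ) ^ 2 * M ^ 2 / (2 * δ) * Real.exp (-(2 * S) / Real.sqrt Wc) *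
          (2 * δ * Real.exp (2 * S / Real.sqrt Wc) * ∑ i ∈ F, φ i ^ 2) := by
        have h2δ : (2 * δ) ≠ 0 := by positivity
        calc _ = (Wc : ℝ) ^ 2 * M ^ 2 * (∑ i ∈ F, φ i ^ 2) * ((2 * δ) / (2 * δ)) * 1 := by
              rw [div_self h2δ]; ring
          _ = _ := by rw [← hexp]; ring
    _ ≤ (Wc : ℝ) ^ 2 * M ^ 2 / (2 * δ) * Real.exp (-(2 * S) / Real.sqrt Wc) *
          (M * ∑ k, φ k ^ 2) := by gcongr
    _ = _ := by ring
end

section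
/- Let A = (a_{ij}) be a nonzero real symmetric N×N matrix, u a vector with all entries nonzero, and Ē ∈ ℝ, with v = (v_i) and ρ = ρ_{A,u,Ē} as in the definitions. Suppose additionally that A is a band matrix of width W ≥ 1, i.e., a_{ij} = 0 whenever |i − j| > W, and suppose there are indices 1 < i₁ ≤ i_q < N and a constant v_min > 0 such that v_i ≥ v_min for every integer i with i₁ ≤ i ≤ i_q. Then ρ(i₁ − 1, i_q + 1) ≥ ⌊(i_q − i₁ + 1 − W)/W⌋ · ln(1 + √(v_min / max_{i,j∈[N]}|a_{ij}|)). -/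
open scoped ENNReal BigOperators
open Matrix

/-- A potential whose increments are bounded by `g` grows along the path by at most `∑ g`. -/
lemma le_add_sum_of_step_le {L : ℕ} (f : Fin (L + 1) → ℝ≥0∞) (g : Fin L → ℝ≥0∞)
    (h : ∀ l : Fin L, f l.succ ≤ f l.castSucc + g l) :
    f (Fin.last L) ≤ f 0 + ∑ l, g l := by
  induction L with
  | zero => simp
  | succ L ih =>
    rw [Fin.sum_univ_castSucc, ← add_assoc]
    have hinit := ih (fun l => f l.castSucc) (fun l => g l.castSucc) fun l => h l.castSucc
    exact (h (Fin.last L)).trans (add_le_add_left hinit _)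

/-- A function satisfying `f j ≤ f i + w(i,j)` on all edges bounds the Agmon distance from below. -/
lemma le_agmonDist_of_step_le {N : ℕ} (A : Matrix (Fin N) (Fin N) ℝ) (u : Fin N → ℝ) (E : ℝ)
    (f : Fin N → ℝ≥0∞) (h : ∀ i j, A i j ≠ 0 → f j ≤ f i + edgeW A u E i j)
    {i j : Fin N} (hi : f i = 0) : f j ≤ agmonDist A u E i j := by
  refine le_iInf fun L => le_iInf fun p => le_iInf fun h0 => le_iInf fun hL => le_iInf fun hp => ?_
  have hsum := le_add_sum_of_step_le (fun l => f (p l)) _ fun l => h _ _ (hp l)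
  simpa only [h0, hL, hi, zero_add] using hsum

lemma abs_le_iSup_iSup_abs {N : ℕ} (A : Matrix (Fin N) (Fin N) ℝ) (i j : Fin N) :
    |A i j| ≤ ⨆ i : Fin N, ⨆ j : Fin N, |A i j| :=
  (le_ciSup (Set.finite_range fun j => |A i j|).bddAbove j).trans
    (le_ciSup (Set.finite_range fun i => ⨆ j : Fin N, |A i j|).bddAbove i)

/-- Edges between sites where the potential is at least `vmin` have weight bounded below. -/
lemma ofReal_log_le_edgeW {N : ℕ} (A : Matrix (Fin N) (Fin N) ℝ) (u : Fin N → ℝ) (E : ℝ)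
    {vmin : ℝ} (hvmin : 0 < vmin) {i j : Fin N} (hij : A i j ≠ 0)
    (hi : vmin ≤ shiftedV A u E i) (hj : vmin ≤ shiftedV A u E j) :
    ENNReal.ofReal (Real.log (1 + Real.sqrt (vmin / ⨆ i : Fin N, ⨆ j : Fin N, |A i j|)))
      ≤ edgeW A u E i j := by
  have hpos : 0 < |A i j| := abs_pos.mpr hij
  have hsqrt : vmin ≤ Real.sqrt (shiftedV A u E i * shiftedV A u E j) :=
    Real.le_sqrt_of_sq_le (by nlinarith)
  have hle := abs_le_iSup_iSup_abs A i j
  refine ENNReal.ofReal_le_ofReal (Real.log_le_log (by positivity) ?_)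
  gcongr

/-- The level `⌊(x - a) / W⌋`, clamped to `[0, m]`, increases only along steps of length at most `W`
inside `[a, b]`, and then by at most one, as soon as `m * W + W ≤ b - a + 1`. -/
lemma clampedLevel_step {W m a b x y : ℕ} (hW : 1 ≤ W) (hm : m * W + W + a ≤ b + 1)
    (hxy : y ≤ x + W) :
    min ((y - a) / W) m ≤ min ((x - a) / W) m ∨
      ((a ≤ x ∧ x ≤ b) ∧ (a ≤ y ∧ y ≤ b)) ∧ min ((y - a) / W) m ≤ min ((x - a) / W) m + 1 := by
  have hfull : b + 1 ≤ x + W → m ≤ (x - a) / W := fun h =>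
    (Nat.le_div_iff_mul_le hW).mpr (by omega)
  have hzero : x < a → (y - a) / W = 0 := fun h => Nat.div_eq_of_lt (by omega)
  have hstep : (y - a) / W ≤ (x - a) / W + 1 := by
    rw [← Nat.add_div_right _ hW]
    exact Nat.div_le_div_right (by omega)
  have hzero' : y < a → (y - a) / W = 0 := fun h => by simp [Nat.sub_eq_zero_of_le h.le]
  generalize (y - a) / W = s at *
  generalize (x - a) / W = t at *
  omega

/-- Band matrix lower bound: let `A ≠ 0` be a real symmetric band matrix of
width `W ≥ 1` (`a_{ij} = 0` for `|i−j| > W`), and suppose `v_i ≥ v_min > 0` for all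
`i₁ ≤ i ≤ i_q` with `1 < i₁ ≤ i_q < N` (in 1-based indexing, i.e. `1 ≤ i₁` and `i_q + 1 < N`
for `Fin N`). Then
`ρ(i₁−1, i_q+1) ≥ ⌊(i_q−i₁+1−W)/W⌋ · ln(1 + √(v_min / max_{i,j}|a_{ij}|))`. -/
theorem band_matrix_distance_lower_bound {N : ℕ} (A : Matrix (Fin N) (Fin N) ℝ)
    (hA0 : A ≠ 0) (hA : A.IsSymm) (u : Fin N → ℝ) (hu : ∀ i, u i ≠ 0) (Ebar : ℝ)
    (W : ℕ) (hW : 1 ≤ W)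
    (hband : ∀ i j : Fin N, (W : ℤ) < |(i.val : ℤ) - (j.val : ℤ)| → A i j = 0)
    (i₁ iq : Fin N) (h1 : 1 ≤ i₁.val) (h12 : i₁ ≤ iq) (h2 : iq.val + 1 < N)
    (vmin : ℝ) (hvmin : 0 < vmin)
    (hv : ∀ i : Fin N, i₁ ≤ i → i ≤ iq → vmin ≤ shiftedV A u Ebar i) :
    ENNReal.ofReal
        ((⌊((iq.val : ℝ) - (i₁.val : ℝ) + 1 - (W : ℝ)) / (W : ℝ)⌋ : ℤ) *
          Real.log (1 + Real.sqrt (vmin / ⨆ i : Fin N, ⨆ j : Fin N, |A i j|)))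
      ≤ agmonDist A u Ebar ⟨i₁.val - 1, lt_of_le_of_lt (Nat.sub_le _ _) i₁.isLt⟩
          ⟨iq.val + 1, h2⟩ := by
  set c := Real.log (1 + Real.sqrt (vmin / ⨆ i : Fin N, ⨆ j : Fin N, |A i j|))
  set z := ⌊((iq.val : ℝ) - (i₁.val : ℝ) + 1 - (W : ℝ)) / (W : ℝ)⌋ with hz
  have hc0 : 0 ≤ c := Real.log_nonneg (le_add_of_nonneg_right (Real.sqrt_nonneg _))
  rcases le_or_gt z 0 with hz0 | hz0
  · rw [ENNReal.ofReal_of_nonpos (mul_nonpos_of_nonpos_of_nonneg (by exact_mod_cast hz0) hc0)]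
    exact zero_le
  obtain ⟨m, hm⟩ : ∃ m : ℕ, z = m := ⟨z.toNat, (Int.toNat_of_nonneg hz0.le).symm⟩
  have hmW : m * W + W + i₁.val ≤ iq.val + 1 := by
    have hfloor := Int.floor_le (((iq.val : ℝ) - (i₁.val : ℝ) + 1 - (W : ℝ)) / (W : ℝ))
    rw [← hz, hm, le_div_iff₀ (by exact_mod_cast hW)] at hfloor
    have hreal : (m : ℝ) * W + W + i₁.val ≤ iq.val + 1 := by
      push_cast at hfloor
      linarith
    exact_mod_cast hreal
  have hdist := le_agmonDist_of_step_le A u Ebar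
    (fun x => ((min ((x.val - i₁.val) / W) m : ℕ) : ℝ≥0∞) * ENNReal.ofReal c) ?_
    (i := ⟨i₁.val - 1, lt_of_le_of_lt (Nat.sub_le _ _) i₁.isLt⟩) (j := ⟨iq.val + 1, h2⟩) ?_
  · have hlast : m ≤ (iq.val + 1 - i₁.val) / W := (Nat.le_div_iff_mul_le hW).mpr (by omega)
    rw [hm, ENNReal.ofReal_mul (by positivity)]
    simpa [min_eq_right hlast] using hdist
  · intro i j hij
    have hband' : j.val ≤ i.val + W := by
      by_contra hlt
      exact hij (hband i j (lt_abs.mpr (Or.inr (by omega))))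
    rcases clampedLevel_step hW hmW hband' with hle | ⟨⟨hi, hj⟩, hle⟩
    · exact le_add_right (by gcongr)
    · calc _ ≤ ((min ((i.val - i₁.val) / W) m + 1 : ℕ) : ℝ≥0∞) * ENNReal.ofReal c := by gcongr
        _ = (min ((i.val - i₁.val) / W) m : ℕ) * ENNReal.ofReal c + ENNReal.ofReal c := by
          rw [Nat.cast_add, Nat.cast_one, add_mul, one_mul]
        _ ≤ _ := by
          gcongr
          exact ofReal_log_le_edgeW A u Ebar hvmin hij (hv i hi.1 hi.2) (hv j hj.1 hj.2)
  · simp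
end
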